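/- Let K and L be h-convex bodies in ℍ^{n+1}. Then the Hausdorff distance between them equals the sup-norm distance of their horospherical support functions: d_H(K,L) = max{|u(K,e) − u(L,e)| : e ∈ 𝕊^n}. -/

import Mathlib

noncomputable section

open Real MeasureTheory Filter Topology Set
open scoped ENNReal symmDiff

namespace Horo

/-- The Lorentzian inner product on ℝ^{n+2}:
`X·Y = Σ_{i=1}^{n+1} x_i y_i − x_{n+2} y_{n+2}`. -/
def lprod (n : ℕ) (X Y : Fin (n + 2) → ℝ) : ℝ :=
  (∑ i : Fin (n + 1), X i.castSucc * Y i.castSucc) - X (Fin.last (n + 1)) * Y (Fin.last (n + 1))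

/-- The hyperboloid model ℍ^{n+1} of hyperbolic space. -/
def Hyp (n : ℕ) : Set (Fin (n + 2) → ℝ) :=
  {X | lprod n X X = -1 ∧ 0 < X (Fin.last (n + 1))}

/-- The origin O = (0,…,0,1) of hyperbolic space. -/
def origin (n : ℕ) : Fin (n + 2) → ℝ := Fin.snoc (fun _ => 0) 1

/-- The unit sphere 𝕊^n ⊂ ℝ^{n+1}. -/
def sph (n : ℕ) : Set (Fin (n + 1) → ℝ) := {e | ∑ i, e i ^ 2 = 1}

/-- The null vector (e,1) ∈ ℝ^{n+2} associated with e ∈ 𝕊^n. -/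
def dir {n : ℕ} (e : Fin (n + 1) → ℝ) : Fin (n + 2) → ℝ := Fin.snoc e 1

/-- The geodesic distance d(X,Y) = arcosh(−X·Y) on the hyperboloid. -/
def dH (n : ℕ) (X Y : Fin (n + 2) → ℝ) : ℝ :=
  Real.log (-(lprod n X Y) + Real.sqrt ((lprod n X Y) ^ 2 - 1))

/-- The horosphere H_e(s) = {X ∈ ℍ^{n+1} : X·(e,1) = −e^s}. -/
def horoSphere (n : ℕ) (e : Fin (n + 1) → ℝ) (s : ℝ) : Set (Fin (n + 2) → ℝ) :=
  {X ∈ Hyp n | lprod n X (dir e) = -Real.exp s}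

/-- The open horo-ball B_e(s) = {X ∈ ℍ^{n+1} : 0 > X·(e,1) > −e^s}. -/
def horoBall (n : ℕ) (e : Fin (n + 1) → ℝ) (s : ℝ) : Set (Fin (n + 2) → ℝ) :=
  {X ∈ Hyp n | 0 > lprod n X (dir e) ∧ lprod n X (dir e) > -Real.exp s}

/-- The closed horo-ball B̄_e(s) = {X ∈ ℍ^{n+1} : 0 > X·(e,1) ≥ −e^s}. -/
def horoBallCl (n : ℕ) (e : Fin (n + 1) → ℝ) (s : ℝ) : Set (Fin (n + 2) → ℝ) :=
  {X ∈ Hyp n | 0 > lprod n X (dir e) ∧ lprod n X (dir e) ≥ -Real.exp s}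

/-- A set Ω ⊂ ℍ^{n+1} is horospherically convex (h-convex) if it is closed and every
relative boundary point of Ω admits a supporting horo-ball. -/
def IsHConvex (n : ℕ) (Ω : Set (Fin (n + 2) → ℝ)) : Prop :=
  Ω ⊆ Hyp n ∧ IsClosed Ω ∧
    ∀ X ∈ Ω ∩ closure (Hyp n \ Ω),
      ∃ e ∈ sph n, ∃ s : ℝ, Ω ⊆ horoBallCl n e s ∧ X ∈ horoSphere n e s

/-- The interior of a subset of the hyperboloid, relative to the hyperboloid. -/
def relInt (n : ℕ) (K : Set (Fin (n + 2) → ℝ)) : Set (Fin (n + 2) → ℝ) :=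
  {X ∈ Hyp n | ∃ ε > 0, ∀ Y ∈ Hyp n, dH n X Y < ε → Y ∈ K}

/-- A h-convex body: a compact h-convex set with nonempty (relative) interior. -/
def IsHConvexBody (n : ℕ) (K : Set (Fin (n + 2) → ℝ)) : Prop :=
  IsHConvex n K ∧ IsCompact K ∧ (relInt n K).Nonempty

/-- A h-convex polytope: a h-convex body which is a finite intersection of closed
horo-balls. -/
def IsHPolytope (n : ℕ) (P : Set (Fin (n + 2) → ℝ)) : Prop :=
  IsHConvexBody n P ∧ ∃ m : ℕ, 2 ≤ m ∧ ∃ (e : Fin m → (Fin (n + 1) → ℝ)) (u : Fin m → ℝ),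
    (∀ i, e i ∈ sph n) ∧ P = ⋂ i, horoBallCl n (e i) (u i)

/-- The horospherical support function u(K,e) = sup{log(−X·(e,1)) : X ∈ K}. -/
def suppFn (n : ℕ) (K : Set (Fin (n + 2) → ℝ)) (e : Fin (n + 1) → ℝ) : ℝ :=
  sSup ((fun X => Real.log (-(lprod n X (dir e)))) '' K)

/-- The outer parallel set K^ε = {X ∈ ℍ^{n+1} : d(K,X) ≤ ε}. -/
def outPar (n : ℕ) (K : Set (Fin (n + 2) → ℝ)) (ε : ℝ) : Set (Fin (n + 2) → ℝ) :=
  {X ∈ Hyp n | ∃ Y ∈ K, dH n Y X ≤ ε}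

/-- The Hausdorff distance d_H(K,L) = inf{ε ≥ 0 : K ⊆ L^ε and L ⊆ K^ε}. -/
def dHaus (n : ℕ) (K L : Set (Fin (n + 2) → ℝ)) : ℝ :=
  sInf {ε : ℝ | 0 ≤ ε ∧ K ⊆ outPar n L ε ∧ L ⊆ outPar n K ε}

/-- The point (sinh r · θ, cosh r) ∈ ℍ^{n+1} at distance r from O in direction θ. -/
def rpt (n : ℕ) (θ : Fin (n + 1) → ℝ) (r : ℝ) : Fin (n + 2) → ℝ :=
  Fin.snoc (fun i => Real.sinh r * θ i) (Real.cosh r)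

/-- The radial function ρ(K,θ) = max{λ ≥ 0 : (sinh λ · θ, cosh λ) ∈ K}. -/
def radFn (n : ℕ) (K : Set (Fin (n + 2) → ℝ)) (θ : Fin (n + 1) → ℝ) : ℝ :=
  sSup {r : ℝ | 0 ≤ r ∧ rpt n θ r ∈ K}

/-- R(K) = max_θ ρ(K,θ). -/
def Rmax (n : ℕ) (K : Set (Fin (n + 2) → ℝ)) : ℝ := sSup (radFn n K '' sph n)

/-- r(K) = min_θ ρ(K,θ). -/
def rmin (n : ℕ) (K : Set (Fin (n + 2) → ℝ)) : ℝ := sInf (radFn n K '' sph n)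

/-- The point reflection (x_1,…,x_{n+1},x_{n+2}) ↦ (−x_1,…,−x_{n+1},x_{n+2}) about O. -/
def symMap (n : ℕ) (X : Fin (n + 2) → ℝ) : Fin (n + 2) → ℝ :=
  fun i => if i = Fin.last (n + 1) then X i else -X i

/-- The hyperbolic (Riemannian) volume of a subset of the hyperboloid, computed via the
graph parametrization x ↦ (x, √(1+|x|²)), whose volume density is 1/√(1+|x|²). -/
def hypVol (n : ℕ) (K : Set (Fin (n + 2) → ℝ)) : ℝ :=
  ∫ x : Fin (n + 1) → ℝ,
    Set.indicator {y : Fin (n + 1) → ℝ | Fin.snoc y (Real.sqrt (1 + ∑ i, y i ^ 2)) ∈ K}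
      (fun y => 1 / Real.sqrt (1 + ∑ i, y i ^ 2)) x

/-- The distance from a point X to a set P. -/
def distTo (n : ℕ) (P : Set (Fin (n + 2) → ℝ)) (X : Fin (n + 2) → ℝ) : ℝ :=
  sInf ((fun Y => dH n Y X) '' P)

/-- The facet F(P,e) = P ∩ H_e(u(P,e)). -/
def facet (n : ℕ) (P : Set (Fin (n + 2) → ℝ)) (e : Fin (n + 1) → ℝ) :
    Set (Fin (n + 2) → ℝ) :=
  P ∩ horoSphere n e (suppFn n P e)

/-- The relative interior of the facet F(P,e) inside the horosphere H_e(u(P,e)). -/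
def facetRelInt (n : ℕ) (P : Set (Fin (n + 2) → ℝ)) (e : Fin (n + 1) → ℝ) :
    Set (Fin (n + 2) → ℝ) :=
  {Y ∈ facet n P e | ∃ δ > 0, ∀ Z ∈ horoSphere n e (suppFn n P e),
    dH n Y Z < δ → Z ∈ facet n P e}

/-- The collar 𝒫_t(P, F̊(P,e)): points at positive distance ≤ t from P whose nearest
point in P lies in the relative interior of the facet F(P,e). -/
def collar (n : ℕ) (P : Set (Fin (n + 2) → ℝ)) (e : Fin (n + 1) → ℝ) (t : ℝ) :
    Set (Fin (n + 2) → ℝ) :=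
  {X ∈ Hyp n | 0 < distTo n P X ∧ distTo n P X ≤ t ∧
    ∃ Y ∈ facetRelInt n P e, ∀ Z ∈ P, dH n Y X ≤ dH n Z X}

/-- The diameter of a set with respect to a distance function, in ℝ≥0∞. -/
def ediamWith {α : Type*} (d : α → α → ℝ) (U : Set α) : ℝ≥0∞ :=
  ⨆ (x ∈ U) (y ∈ U), ENNReal.ofReal (d x y)

/-- The (unnormalized) s-dimensional Hausdorff measure associated with a distance
function d, via the Carathéodory construction. -/
def hMeasWith {α : Type*} (d : α → α → ℝ) (s : ℕ) (A : Set α) : ℝ≥0∞ :=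
  ⨆ (δ : ℝ) (_ : 0 < δ),
    ⨅ (U : ℕ → Set α) (_ : A ⊆ ⋃ i, U i) (_ : ∀ i, ediamWith d (U i) ≤ ENNReal.ofReal δ),
      ∑' i, ediamWith d (U i) ^ s

/-- ω_n, the volume of the unit ball in ℝ^n. -/
def unitBallVol (n : ℕ) : ℝ :=
  (volume (Metric.ball (0 : EuclideanSpace ℝ (Fin n)) 1)).toReal

/-- S(P,e): the n-dimensional area of the facet F(P,e), i.e. the normalized
n-dimensional Hausdorff measure of F(P,e) with respect to the hyperbolic distance. -/
def areaFacet (n : ℕ) (P : Set (Fin (n + 2) → ℝ)) (e : Fin (n + 1) → ℝ) : ℝ :=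
  (ENNReal.ofReal (unitBallVol n / 2 ^ n) * hMeasWith (dH n) n (facet n P e)).toReal

section Lorentz

variable {n : ℕ}

lemma lprod_comm (X Y : Fin (n + 2) → ℝ) : lprod n X Y = lprod n Y X := by
  simp only [lprod, mul_comm]

lemma lprod_add_left (X Y Z : Fin (n + 2) → ℝ) :
    lprod n (X + Y) Z = lprod n X Z + lprod n Y Z := by
  simp only [lprod, Pi.add_apply, add_mul, Finset.sum_add_distrib]
  ring

lemma lprod_smul_left (c : ℝ) (X Z : Fin (n + 2) → ℝ) :
    lprod n (c • X) Z = c * lprod n X Z := by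
  simp only [lprod, Pi.smul_apply, smul_eq_mul, mul_assoc, ← Finset.mul_sum, mul_sub]

lemma lprod_sub_left (X Y Z : Fin (n + 2) → ℝ) :
    lprod n (X - Y) Z = lprod n X Z - lprod n Y Z := by
  simp only [lprod, Pi.sub_apply, sub_mul, Finset.sum_sub_distrib]
  ring

lemma lprod_add_right (X Y Z : Fin (n + 2) → ℝ) :
    lprod n Z (X + Y) = lprod n Z X + lprod n Z Y := by
  simp only [lprod_comm Z, lprod_add_left]

lemma lprod_smul_right (c : ℝ) (X Z : Fin (n + 2) → ℝ) :
    lprod n Z (c • X) = c * lprod n Z X := by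
  simp only [lprod_comm Z, lprod_smul_left]

lemma lprod_sub_right (X Y Z : Fin (n + 2) → ℝ) :
    lprod n Z (X - Y) = lprod n Z X - lprod n Z Y := by
  simp only [lprod_comm Z, lprod_sub_left]

lemma continuous_lprod :
    Continuous fun p : (Fin (n + 2) → ℝ) × (Fin (n + 2) → ℝ) => lprod n p.1 p.2 := by
  unfold lprod
  fun_prop

lemma continuous_lprod_left (Y : Fin (n + 2) → ℝ) : Continuous fun X => lprod n X Y := by
  unfold lprod
  fun_prop

lemma lprod_self (X : Fin (n + 2) → ℝ) :
    lprod n X X = (∑ i : Fin (n + 1), X i.castSucc ^ 2) - X (Fin.last (n + 1)) ^ 2 := by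
  simp only [lprod, sq]

lemma lprod_dir_self {e : Fin (n + 1) → ℝ} (he : e ∈ sph n) :
    lprod n (dir e) (dir e) = 0 := by
  have h : ∑ i, e i ^ 2 = 1 := he
  simp [lprod_self, dir, h]

lemma dir_last (e : Fin (n + 1) → ℝ) : dir e (Fin.last (n + 1)) = 1 := by simp [dir]

/-- The reverse Cauchy–Schwarz inequality for future timelike vectors. -/
lemma one_le_neg_lprod {X Y : Fin (n + 2) → ℝ} (hX : X ∈ Hyp n) (hY : Y ∈ Hyp n) :
    1 ≤ -lprod n X Y := by
  obtain ⟨hX1, hX2⟩ := hX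
  obtain ⟨hY1, hY2⟩ := hY
  have hcs := Finset.sum_mul_sq_le_sq_mul_sq Finset.univ
    (fun i : Fin (n + 1) => X i.castSucc) (fun i => Y i.castSucc)
  rw [lprod_self] at hX1 hY1
  rw [lprod]
  set S := ∑ i : Fin (n + 1), X i.castSucc * Y i.castSucc
  set x := X (Fin.last (n + 1))
  set y := Y (Fin.last (n + 1))
  rw [show ∑ i : Fin (n + 1), X i.castSucc ^ 2 = x ^ 2 - 1 by linarith,
    show ∑ i : Fin (n + 1), Y i.castSucc ^ 2 = y ^ 2 - 1 by linarith] at hcs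
  have hx : 1 ≤ x ^ 2 := by
    have : 0 ≤ ∑ i : Fin (n + 1), X i.castSucc ^ 2 := Finset.sum_nonneg fun i _ => sq_nonneg _
    linarith
  have hy : 1 ≤ y ^ 2 := by
    have : 0 ≤ ∑ i : Fin (n + 1), Y i.castSucc ^ 2 := Finset.sum_nonneg fun i _ => sq_nonneg _
    linarith
  have hxy : 1 ≤ x * y := by
    have := one_le_mul_of_one_le_of_one_le
      ((one_le_sq_iff₀ hX2.le).1 hx) ((one_le_sq_iff₀ hY2.le).1 hy)
    exact this
  have : S ≤ x * y - 1 := by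
    refine abs_le_of_sq_le_sq' ?_ (by linarith) |>.2
    nlinarith [sq_nonneg (x - y)]
  linarith

lemma lprod_dir_neg {X : Fin (n + 2) → ℝ} {e : Fin (n + 1) → ℝ} (hX : X ∈ Hyp n)
    (he : e ∈ sph n) : lprod n X (dir e) < 0 := by
  obtain ⟨hX1, hX2⟩ := hX
  have he' : ∑ i, e i ^ 2 = 1 := he
  have hcs := Finset.sum_mul_sq_le_sq_mul_sq Finset.univ
    (fun i : Fin (n + 1) => X i.castSucc) e
  rw [lprod_self] at hX1
  have hS : ∑ i : Fin (n + 1), X i.castSucc * e i < X (Fin.last (n + 1)) := by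
    refine abs_lt_of_sq_lt_sq' ?_ hX2.le |>.2
    rw [he'] at hcs
    linarith
  simpa [lprod, dir] using hS

lemma lprod_dir_dir_nonpos {e f : Fin (n + 1) → ℝ} (he : e ∈ sph n) (hf : f ∈ sph n) :
    lprod n (dir e) (dir f) ≤ 0 := by
  have he' : ∑ i, e i ^ 2 = 1 := he
  have hf' : ∑ i, f i ^ 2 = 1 := hf
  have hcs := Finset.sum_mul_sq_le_sq_mul_sq Finset.univ e f
  rw [he', hf', mul_one, sq_le_one_iff_abs_le_one] at hcs
  simpa [lprod, dir] using (abs_le.1 hcs).2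

lemma last_pos_of_lprod_neg {X W : Fin (n + 2) → ℝ} (hX : lprod n X X ≤ 0)
    (hX0 : 0 < X (Fin.last (n + 1))) (hW : lprod n W W ≤ 0) (hWX : lprod n W X < 0) :
    0 < W (Fin.last (n + 1)) := by
  by_contra! h
  have hcs := Finset.sum_mul_sq_le_sq_mul_sq Finset.univ
    (fun i : Fin (n + 1) => W i.castSucc) (fun i => X i.castSucc)
  rw [lprod_self] at hX hW
  rw [lprod] at hWX
  have hle := mul_le_mul (sub_nonpos.1 hW) (sub_nonpos.1 hX)
    (Finset.sum_nonneg fun i _ => sq_nonneg _) (sq_nonneg _)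
  have hneg := mul_nonpos_of_nonpos_of_nonneg h hX0.le
  nlinarith

lemma mem_Hyp_of_lprod_dir_neg {W : Fin (n + 2) → ℝ} {e : Fin (n + 1) → ℝ} (he : e ∈ sph n)
    (hW : lprod n W W = -1) (hWe : lprod n W (dir e) < 0) : W ∈ Hyp n :=
  ⟨hW, last_pos_of_lprod_neg (lprod_dir_self he).le (by simp [dir_last]) (by linarith) hWe⟩

/-- A null vector in the future cone is a positive multiple of some `dir e`. -/
lemma exists_eq_smul_dir {Y N : Fin (n + 2) → ℝ} (hY : Y ∈ Hyp n) (hN : lprod n N N = 0)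
    (hNY : lprod n N Y < 0) : ∃ e ∈ sph n, ∃ k : ℝ, 0 < k ∧ N = k • dir e := by
  have hpos := last_pos_of_lprod_neg (by linarith [hY.1]) hY.2 hN.le hNY
  set k := N (Fin.last (n + 1)) with hk
  refine ⟨fun i => N i.castSucc / k, ?_, k, hpos, ?_⟩
  · rw [lprod_self] at hN
    simp only [sph, mem_ofPred_eq, div_pow, ← Finset.sum_div]
    rw [div_eq_one_iff_eq (by positivity)]
    linarith
  · funext i
    refine Fin.lastCases ?_ (fun i => ?_) i
    · simp [dir, hk]
    · simp [dir, mul_div_cancel₀ _ hpos.ne']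

/-- The point at distance `r` from `Y` on the geodesic ray from `Y` running away from the ideal
point `e`. -/
def recede (n : ℕ) (Y : Fin (n + 2) → ℝ) (e : Fin (n + 1) → ℝ) (r : ℝ) : Fin (n + 2) → ℝ :=
  exp r • Y - (sinh r / -lprod n Y (dir e)) • dir e

lemma lprod_recede_dir (Y : Fin (n + 2) → ℝ) {e : Fin (n + 1) → ℝ} (he : e ∈ sph n) (r : ℝ) :
    lprod n (recede n Y e r) (dir e) = exp r * lprod n Y (dir e) := by
  simp only [recede, lprod_sub_left, lprod_smul_left, lprod_dir_self he]
  ring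

lemma lprod_recede (X : Fin (n + 2) → ℝ) (Y : Fin (n + 2) → ℝ) (e : Fin (n + 1) → ℝ) (r : ℝ) :
    lprod n X (recede n Y e r) =
      exp r * lprod n X Y - sinh r / -lprod n Y (dir e) * lprod n X (dir e) := by
  simp only [recede, lprod_sub_right, lprod_smul_right]

lemma lprod_self_recede {Y : Fin (n + 2) → ℝ} {e : Fin (n + 1) → ℝ} (hY : Y ∈ Hyp n)
    (he : e ∈ sph n) (r : ℝ) : lprod n Y (recede n Y e r) = -cosh r := by
  have hb := lprod_dir_neg hY he
  rw [lprod_recede, hY.1, ← cosh_add_sinh]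
  field_simp [hb.ne]
  ring

lemma recede_mem_Hyp {Y : Fin (n + 2) → ℝ} {e : Fin (n + 1) → ℝ} (hY : Y ∈ Hyp n)
    (he : e ∈ sph n) (r : ℝ) : recede n Y e r ∈ Hyp n := by
  have hb := lprod_dir_neg hY he
  refine mem_Hyp_of_lprod_dir_neg he ?_ ?_
  · rw [lprod_recede, lprod_comm _ Y, lprod_self_recede hY he, lprod_recede_dir Y he,
      ← cosh_add_sinh]
    field_simp [hb.ne]
    linarith [cosh_sq r]
  · rw [lprod_recede_dir Y he]
    exact mul_neg_of_pos_of_neg (exp_pos r) hb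

lemma dH_eq_arcosh (X Y : Fin (n + 2) → ℝ) : dH n X Y = arcosh (-lprod n X Y) := by
  simp [dH, arcosh]

lemma dH_le_iff {X Y : Fin (n + 2) → ℝ} (hX : X ∈ Hyp n) (hY : Y ∈ Hyp n) {r : ℝ}
    (hr : 0 ≤ r) : dH n X Y ≤ r ↔ -lprod n X Y ≤ cosh r := by
  rw [dH_eq_arcosh]
  nth_rw 1 [← arcosh_cosh hr]
  exact arcosh_le_arcosh (by linarith [one_le_neg_lprod hX hY]) (cosh_pos r)

lemma neg_lprod_dir_le_of_dH_le {X Y : Fin (n + 2) → ℝ} {e : Fin (n + 1) → ℝ}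
    (hX : X ∈ Hyp n) (hY : Y ∈ Hyp n) (he : e ∈ sph n) {r : ℝ} (hr : 0 ≤ r)
    (h : dH n Y X ≤ r) : -lprod n X (dir e) ≤ exp r * -lprod n Y (dir e) := by
  have key : ∀ t ∈ Ioi r, -lprod n X (dir e) ≤ exp t * -lprod n Y (dir e) := by
    intro t ht
    have ht0 : 0 < t := hr.trans_lt ht
    have hle := (dH_le_iff hY hX ht0.le).1 (h.trans (le_of_lt ht))
    have h1 := one_le_neg_lprod hX (recede_mem_Hyp hY he t)
    have hb := lprod_dir_neg hY he
    have hs := sinh_pos_iff.2 ht0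
    rw [lprod_recede, lprod_comm X Y] at h1
    have h2 : sinh t / -lprod n Y (dir e) * -lprod n X (dir e) ≤ exp t * sinh t := by
      have := mul_le_mul_of_nonneg_left hle (exp_pos t).le
      have h3 : exp t * cosh t - 1 = exp t * sinh t := by
        rw [← cosh_add_sinh]; linarith [cosh_sq t, sq (cosh t), sq (sinh t)]
      linarith
    rw [div_mul_eq_mul_div, div_le_iff₀ (by linarith)] at h2
    nlinarith
  refine ge_of_tendsto (x := 𝓝[>] r) ?_ (eventually_mem_nhdsWithin.mono key)
  exact ((continuous_exp.mul continuous_const).tendsto r).mono_left nhdsWithin_le_nhds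

end Lorentz

section Support

variable {n : ℕ}

lemma sph_nonempty : (sph n).Nonempty :=
  ⟨Pi.single 0 1, by simp [sph, Pi.single_apply]⟩

lemma bddAbove_suppFn {K : Set (Fin (n + 2) → ℝ)} (hK : IsCompact K) (hKH : K ⊆ Hyp n)
    {e : Fin (n + 1) → ℝ} (he : e ∈ sph n) :
    BddAbove ((fun X => Real.log (-(lprod n X (dir e)))) '' K) := by
  refine hK.bddAbove_image ?_
  refine ContinuousOn.log (continuous_lprod_left _).neg.continuousOn fun X hX => ?_
  have := lprod_dir_neg (hKH hX) he
  linarith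

lemma suppFn_le_add {K L : Set (Fin (n + 2) → ℝ)} (hK : K ⊆ Hyp n) (hK0 : K.Nonempty)
    (hL : L ⊆ Hyp n) (hLc : IsCompact L) {e : Fin (n + 1) → ℝ} (he : e ∈ sph n) {r : ℝ}
    (hr : 0 ≤ r) (h : K ⊆ outPar n L r) : suppFn n K e ≤ suppFn n L e + r := by
  refine csSup_le (hK0.image _) ?_
  rintro _ ⟨X, hX, rfl⟩
  obtain ⟨-, Y, hY, hd⟩ := h hX
  have h1 := neg_lprod_dir_le_of_dH_le (hK hX) (hL hY) he hr hd
  have hX0 := lprod_dir_neg (hK hX) he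
  have hY0 := lprod_dir_neg (hL hY) he
  have h2 := Real.log_le_log (by linarith) h1
  rw [Real.log_mul (exp_pos r).ne' (by linarith), Real.log_exp] at h2
  have h3 : Real.log (-lprod n Y (dir e)) ≤ suppFn n L e :=
    le_csSup (bddAbove_suppFn hLc hL he) ⟨Y, hY, rfl⟩
  dsimp only
  linarith

lemma relInt_subset (L : Set (Fin (n + 2) → ℝ)) : relInt n L ⊆ L :=
  fun P ⟨hP, _, hr, hball⟩ => hball P hP (by simpa [dH_eq_arcosh, hP.1] using hr)

/-- Horo-balls containing a set contain its relative interior in their interior. -/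
lemma neg_lprod_lt_of_mem_relInt {L : Set (Fin (n + 2) → ℝ)} {P : Fin (n + 2) → ℝ}
    {e : Fin (n + 1) → ℝ} {s : ℝ} (he : e ∈ sph n) (hP : P ∈ relInt n L)
    (hL : L ⊆ horoBallCl n e s) : -lprod n P (dir e) < exp s := by
  obtain ⟨hPH, r, hr, hball⟩ := hP
  have hd : dH n P (recede n P e (r / 2)) < r := by
    rw [dH_eq_arcosh, lprod_self_recede hPH he, neg_neg, arcosh_cosh (by linarith)]
    linarith
  have h := (hL (hball _ (recede_mem_Hyp hPH he _) hd)).2.2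
  rw [lprod_recede_dir P he] at h
  have hb := lprod_dir_neg hPH he
  have h1 : 1 < exp (r / 2) := one_lt_exp_iff.2 (by linarith)
  nlinarith

/-- A h-convex body contains every point lying in all the horo-balls that contain the body. -/
lemma IsHConvexBody.mem_of_forall_horoBallCl {L : Set (Fin (n + 2) → ℝ)}
    (hL : IsHConvexBody n L) {W : Fin (n + 2) → ℝ} (hW : W ∈ Hyp n)
    (h : ∀ e ∈ sph n, ∀ s : ℝ, L ⊆ horoBallCl n e s → W ∈ horoBallCl n e s) : W ∈ L := by
  obtain ⟨⟨hLH, hLcl, hsupp⟩, -, P, hP⟩ := hL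
  have hPH := hP.1
  have hPL := relInt_subset L hP
  by_contra hWL
  set c := -lprod n P W - 1 with hc
  have hc0 : 0 ≤ c := by linarith [one_le_neg_lprod hPH hW]
  let q : ℝ → ℝ := fun t => √(1 + 2 * |t * (1 - t)| * c)
  have hq1 : ∀ t, 1 ≤ q t := fun t => Real.one_le_sqrt.2 (by
    have : 0 ≤ 2 * |t * (1 - t)| * c := by positivity
    linarith)
  let γ : ℝ → Fin (n + 2) → ℝ := fun t => (q t)⁻¹ • ((1 - t) • P + t • W)
  have hγ : Continuous γ := by
    have hq : Continuous q := by fun_prop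
    exact (hq.inv₀ fun t => by linarith [hq1 t]).smul (by fun_prop)
  have hγe : ∀ t e, lprod n (γ t) (dir e) =
      (q t)⁻¹ * ((1 - t) * lprod n P (dir e) + t * lprod n W (dir e)) := fun t e => by
    simp only [γ, lprod_add_left, lprod_smul_left]
  have hγH : ∀ t ∈ Icc (0 : ℝ) 1, γ t ∈ Hyp n := by
    rintro t ⟨ht0, ht1⟩
    obtain ⟨e, he⟩ := sph_nonempty (n := n)
    have hqp : 0 < q t := by linarith [hq1 t]
    refine mem_Hyp_of_lprod_dir_neg he ?_ ?_
    · have hq2 : q t ^ 2 = 1 + 2 * (t * (1 - t)) * c := by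
        have h0 : 0 ≤ t * (1 - t) := mul_nonneg ht0 (by linarith)
        simp only [q]
        rw [Real.sq_sqrt (by positivity), abs_of_nonneg h0]
      simp only [γ, lprod_add_left, lprod_smul_left, lprod_add_right, lprod_smul_right,
        lprod_comm W P, hPH.1, hW.1]
      rw [show lprod n P W = -c - 1 by linarith]
      field_simp
      rw [hq2]
      ring
    · rw [hγe]
      have h1 := lprod_dir_neg hPH he
      have h2 := lprod_dir_neg hW he
      exact mul_neg_of_pos_of_neg (by positivity)
        (convex_Iio (0 : ℝ) h1 h2 (sub_nonneg.2 ht1) ht0 (sub_add_cancel 1 t))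
  obtain ⟨t, ⟨⟨ht0, ht1⟩, htL⟩, htmax⟩ : ∃ t, IsGreatest (Icc (0 : ℝ) 1 ∩ γ ⁻¹' L) t :=
    (isCompact_Icc.inter_right (hLcl.preimage hγ)).exists_isGreatest
      ⟨0, by simp, by simpa [γ, q] using hPL⟩
  have hlt : t < 1 := by
    refine lt_of_le_of_ne ht1 ?_
    rintro rfl
    exact hWL (by simpa [γ, q] using htL)
  have hbd : γ t ∈ closure (Hyp n \ L) := by
    refine mem_closure_of_tendsto (b := 𝓝[>] t)
      ((hγ.tendsto t).mono_left nhdsWithin_le_nhds) ?_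
    filter_upwards [Ioo_mem_nhdsGT hlt] with u hu
    have huI : u ∈ Icc (0 : ℝ) 1 := ⟨ht0.trans hu.1.le, hu.2.le⟩
    exact ⟨hγH u huI, fun huL => absurd (htmax ⟨huI, huL⟩) (not_le.2 hu.1)⟩
  obtain ⟨e, he, s, hLs, -, hs⟩ := hsupp _ ⟨htL, hbd⟩
  have h1 := neg_lprod_lt_of_mem_relInt he hP hLs
  have h2 := (h e he s hLs).2.2
  have hqp : 0 < q t := by linarith [hq1 t]
  rw [hγe, inv_mul_eq_iff_eq_mul₀ hqp.ne'] at hs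
  have := mul_le_mul_of_nonneg_right (hq1 t) (exp_pos s).le
  nlinarith

/-- At a point `Y` of a h-convex body nearest to an outer point `X`, the horo-ball through `Y`
centred at the end of the ray from `X` through `Y` contains the body. -/
lemma IsHConvexBody.lprod_null_ge {L : Set (Fin (n + 2) → ℝ)} (hL : IsHConvexBody n L)
    {X Y Z : Fin (n + 2) → ℝ} (hY : Y ∈ L) (hZ : Z ∈ L)
    (hmin : ∀ V ∈ L, lprod n X V ≤ lprod n X Y) {δ : ℝ} (hδ : 0 < δ)
    (hXY : lprod n X Y = -cosh δ) {e : Fin (n + 1) → ℝ} (he : e ∈ sph n) {k : ℝ} (hk : 0 < k)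
    (hN : exp δ • Y - X = (sinh δ * k) • dir e) : lprod n Y (dir e) ≤ lprod n Z (dir e) := by
  have hYH := hL.1.1 hY
  have hZH := hL.1.1 hZ
  have hs : 0 < sinh δ := sinh_pos_iff.2 hδ
  have hnY : k * lprod n Y (dir e) = -1 := by
    have := congrArg (lprod n Y) hN
    rw [lprod_sub_right, lprod_smul_right, lprod_smul_right, hYH.1, lprod_comm Y X, hXY,
      ← cosh_add_sinh] at this
    exact mul_left_cancel₀ hs.ne' (by linarith)
  have hnX : lprod n X (dir e) = exp δ * lprod n Y (dir e) := by
    have := congrArg (fun V => lprod n V (dir e)) hN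
    simp only [lprod_sub_left, lprod_smul_left, lprod_dir_self he] at this
    linarith
  have hnZ : sinh δ * (k * lprod n Z (dir e)) = exp δ * lprod n Y Z - lprod n X Z := by
    have := congrArg (lprod n Z) hN
    rw [lprod_sub_right, lprod_smul_right, lprod_smul_right, lprod_comm Z Y,
      lprod_comm Z X] at this
    linarith
  have hY0 := lprod_dir_neg hYH he
  have hZ0 := lprod_dir_neg hZH he
  set y := lprod n Y (dir e) with hy
  set z := lprod n Z (dir e) with hz
  set c := -lprod n Y Z - 1 with hc
  have hc0 : 0 ≤ c := by linarith [one_le_neg_lprod hYH hZH]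
  -- the points `(1 - t) Y + t Z - l (e, 1)` of the hyperboloid stay in `L`
  have key : ∀ t ∈ Ioo (0 : ℝ) 1, 0 ≤ (lprod n X Y - lprod n X Z) * -((1 - t) * y + t * z) +
      (1 - t) * c * (exp δ * y) := by
    rintro t ⟨ht0, ht1⟩
    have hw : 0 < -((1 - t) * y + t * z) := by nlinarith
    set w := -((1 - t) * y + t * z) with hw'
    set l := t * (1 - t) * c / w with hl
    have hlw : l * w = t * (1 - t) * c := div_mul_cancel₀ _ hw.ne'
    have hl0 : 0 ≤ l := div_nonneg (mul_nonneg (mul_nonneg ht0.le (by linarith)) hc0) hw.le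
    have hVL : (1 - t) • Y + t • Z - l • dir e ∈ L := by
      have hVH : (1 - t) • Y + t • Z - l • dir e ∈ Hyp n := by
        refine mem_Hyp_of_lprod_dir_neg he ?_ ?_
        · simp only [lprod_sub_left, lprod_add_left, lprod_smul_left, lprod_sub_right,
            lprod_add_right, lprod_smul_right, lprod_dir_self he, lprod_comm Z Y,
            lprod_comm (dir e), hYH.1, hZH.1, ← hy, ← hz]
          rw [show lprod n Y Z = -c - 1 by linarith]
          linear_combination 2 * hlw - 2 * l * hw'
        · simp only [lprod_sub_left, lprod_add_left, lprod_smul_left, lprod_dir_self he]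
          linarith
      refine hL.mem_of_forall_horoBallCl hVH fun f hf s hLs => ⟨hVH, lprod_dir_neg hVH hf, ?_⟩
      have h1 := (hLs hY).2.2
      have h2 := (hLs hZ).2.2
      have h3 : lprod n (dir e) (dir f) ≤ 0 := lprod_dir_dir_nonpos he hf
      simp only [lprod_sub_left, lprod_add_left, lprod_smul_left]
      nlinarith [mul_nonpos_of_nonneg_of_nonpos hl0 h3]
    have h := hmin _ hVL
    simp only [lprod_sub_right, lprod_add_right, lprod_smul_right, hnX] at h
    have h' : 0 ≤ t * (lprod n X Y - lprod n X Z) + l * (exp δ * y) := by linarith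
    have h'' := mul_nonneg h' hw.le
    have : t * ((lprod n X Y - lprod n X Z) * w + (1 - t) * c * (exp δ * y)) =
        (t * (lprod n X Y - lprod n X Z) + l * (exp δ * y)) * w := by
      linear_combination -(exp δ * y) * hlw
    exact nonneg_of_mul_nonneg_right (this ▸ h'') ht0
  have hlim : 0 ≤ (lprod n X Y - lprod n X Z) * -((1 - 0) * y + 0 * z) +
      (1 - 0) * c * (exp δ * y) := by
    refine ge_of_tendsto (x := 𝓝[>] (0 : ℝ)) (f := fun t : ℝ =>
      (lprod n X Y - lprod n X Z) * -((1 - t) * y + t * z) + (1 - t) * c * (exp δ * y)) ?_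
      (by filter_upwards [Ioo_mem_nhdsGT one_pos] with t ht using key t ht)
    exact (Continuous.tendsto (by fun_prop) 0).mono_left nhdsWithin_le_nhds
  have h0 : 0 ≤ (lprod n X Y - lprod n X Z) - c * exp δ := by
    have : 0 ≤ ((lprod n X Y - lprod n X Z) - c * exp δ) * -y := by linarith
    exact nonneg_of_mul_nonneg_left this (by linarith)
  rw [hXY] at h0
  have h1 : sinh δ * (k * y) ≤ sinh δ * (k * z) := by
    rw [hnZ, hnY, show lprod n Y Z = -c - 1 by linarith]
    linarith [cosh_add_sinh δ]
  exact le_of_mul_le_mul_left (le_of_mul_le_mul_left h1 hs) hk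

lemma IsHConvexBody.exists_add_suppFn_le {L : Set (Fin (n + 2) → ℝ)} (hL : IsHConvexBody n L)
    {X Y : Fin (n + 2) → ℝ} (hX : X ∈ Hyp n) (hY : Y ∈ L)
    (hmin : ∀ V ∈ L, lprod n X V ≤ lprod n X Y) {δ : ℝ} (hδ : 0 < δ)
    (hXY : lprod n X Y = -cosh δ) :
    ∃ e ∈ sph n, δ + suppFn n L e ≤ Real.log (-lprod n X (dir e)) := by
  have hYH := hL.1.1 hY
  have hs : 0 < sinh δ := sinh_pos_iff.2 hδ
  have hEY : exp δ = cosh δ + sinh δ := (cosh_add_sinh δ).symm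
  obtain ⟨e, he, k, hk, hN⟩ := exists_eq_smul_dir (N := exp δ • Y - X) hYH
    (by
      simp only [lprod_sub_left, lprod_smul_left, lprod_sub_right, lprod_smul_right,
        lprod_comm Y X, hXY, hYH.1, hX.1, hEY]
      linear_combination cosh_sq δ)
    (by
      simp only [lprod_sub_left, lprod_smul_left, hXY, hYH.1, hEY]
      linarith)
  refine ⟨e, he, ?_⟩
  have hN' : exp δ • Y - X = (sinh δ * (k / sinh δ)) • dir e := by
    rw [hN, mul_div_cancel₀ _ hs.ne']
  have hnX : lprod n X (dir e) = exp δ * lprod n Y (dir e) := by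
    have := congrArg (fun V => lprod n V (dir e)) hN
    simp only [lprod_sub_left, lprod_smul_left, lprod_dir_self he] at this
    linarith
  have hY0 := lprod_dir_neg hYH he
  have hsup : suppFn n L e ≤ Real.log (-lprod n Y (dir e)) := by
    refine csSup_le (Set.Nonempty.image _ ⟨Y, hY⟩) ?_
    rintro _ ⟨Z, hZ, rfl⟩
    have hZ0 := lprod_dir_neg (hL.1.1 hZ) he
    refine Real.log_le_log (by linarith) (neg_le_neg ?_)
    exact hL.lprod_null_ge hY hZ hmin hδ hXY he (div_pos hk hs) hN'
  rw [hnX, ← mul_neg, Real.log_mul (exp_pos δ).ne' (by linarith), Real.log_exp]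
  linarith

lemma outPar_mono (L : Set (Fin (n + 2) → ℝ)) {r s : ℝ} (h : r ≤ s) :
    outPar n L r ⊆ outPar n L s :=
  fun _ ⟨hX, Y, hY, hd⟩ => ⟨hX, Y, hY, hd.trans h⟩

lemma IsHConvexBody.nonempty {K : Set (Fin (n + 2) → ℝ)} (hK : IsHConvexBody n K) :
    K.Nonempty :=
  hK.2.2.mono (relInt_subset K)

/-- The one-sided Hausdorff distance is realised by the support functions. -/
lemma IsHConvexBody.exists_subset_outPar {K L : Set (Fin (n + 2) → ℝ)}
    (hK : IsHConvexBody n K) (hL : IsHConvexBody n L) :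
    ∃ δ, 0 ≤ δ ∧ K ⊆ outPar n L δ ∧ ∃ e ∈ sph n, δ ≤ |suppFn n K e - suppFn n L e| := by
  have hKH := hK.1.1
  have hLH := hL.1.1
  have hnear : ∀ X, ∃ Y ∈ L, sInf ((fun Y => -lprod n X Y) '' L) = -lprod n X Y ∧
      ∀ V ∈ L, -lprod n X Y ≤ -lprod n X V := fun X =>
    hL.2.1.exists_sInf_image_eq_and_le hL.nonempty
      (by simp only [lprod_comm X]; exact (continuous_lprod_left X).neg.continuousOn)
  obtain ⟨X, hX, hmax⟩ := hK.2.1.exists_isMaxOn hK.nonempty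
    (hL.2.1.continuous_sInf (f := fun X Y => -lprod n X Y) continuous_lprod.neg).continuousOn
  obtain ⟨Y, hY, hinf, hmin⟩ := hnear X
  have h1 := one_le_neg_lprod (hKH hX) (hLH hY)
  refine ⟨arcosh (-lprod n X Y), arcosh_nonneg h1, fun X' hX' => ?_, ?_⟩
  · obtain ⟨Y', hY', hinf', -⟩ := hnear X'
    refine ⟨hKH hX', Y', hY', ?_⟩
    have hle := hmax hX'
    simp only [mem_ofPred_eq, hinf, hinf'] at hle
    rw [dH_eq_arcosh, lprod_comm Y' X']
    exact (arcosh_le_arcosh (by linarith [one_le_neg_lprod (hKH hX') (hLH hY')])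
      (by linarith)).2 hle
  · rcases (arcosh_nonneg h1).eq_or_lt with h0 | hpos
    · obtain ⟨e, he⟩ := sph_nonempty (n := n)
      exact ⟨e, he, h0 ▸ abs_nonneg _⟩
    · obtain ⟨e, he, hle⟩ := hL.exists_add_suppFn_le (hKH hX) hY
        (fun V hV => neg_le_neg_iff.1 (hmin V hV)) hpos (by rw [cosh_arcosh h1, neg_neg])
      have hXK : Real.log (-lprod n X (dir e)) ≤ suppFn n K e :=
        le_csSup (bddAbove_suppFn hK.2.1 hKH he) ⟨X, hX, rfl⟩
      exact ⟨e, he, le_trans (by linarith) (le_abs_self _)⟩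

end Support

/-- The Hausdorff distance between two h-convex bodies equals the maximum of
`|u(K,e) − u(L,e)|` over `e ∈ 𝕊^n` (and the maximum is attained). -/
theorem dHaus_eq_max_suppFn (n : ℕ) (hn : 1 ≤ n)
    (K L : Set (Fin (n + 2) → ℝ)) (hK : IsHConvexBody n K) (hL : IsHConvexBody n L) :
    IsGreatest ((fun e => |suppFn n K e - suppFn n L e|) '' sph n) (dHaus n K L) := by
  have hbound : ∀ e ∈ sph n, ∀ r, 0 ≤ r ∧ K ⊆ outPar n L r ∧ L ⊆ outPar n K r →
      |suppFn n K e - suppFn n L e| ≤ r := by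
    rintro e he r ⟨hr, hKL, hLK⟩
    have h1 := suppFn_le_add hK.1.1 hK.nonempty hL.1.1 hL.2.1 he hr hKL
    have h2 := suppFn_le_add hL.1.1 hL.nonempty hK.1.1 hK.2.1 he hr hLK
    exact abs_sub_le_iff.2 ⟨by linarith, by linarith⟩
  obtain ⟨r, hr, ⟨hKL, hLK⟩, e, he, hle⟩ : ∃ r, 0 ≤ r ∧
      (K ⊆ outPar n L r ∧ L ⊆ outPar n K r) ∧
      ∃ e ∈ sph n, r ≤ |suppFn n K e - suppFn n L e| := by
    obtain ⟨a, ha, hKa, e, he, hae⟩ := hK.exists_subset_outPar hL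
    obtain ⟨b, hb, hLb, f, hf, hbf⟩ := hL.exists_subset_outPar hK
    rcases le_total a b with hab | hab
    · exact ⟨b, hb, ⟨hKa.trans (outPar_mono L hab), hLb⟩, f, hf, by rwa [abs_sub_comm]⟩
    · exact ⟨a, ha, ⟨hKa, hLb.trans (outPar_mono K hab)⟩, e, he, hae⟩
  have hleast : IsLeast {r : ℝ | 0 ≤ r ∧ K ⊆ outPar n L r ∧ L ⊆ outPar n K r} r :=
    ⟨⟨hr, hKL, hLK⟩, fun s hs => hle.trans (hbound e he s hs)⟩
  have hd : dHaus n K L = r := hleast.csInf_eq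
  rw [hd]
  refine ⟨⟨e, he, le_antisymm (hbound e he r ⟨hr, hKL, hLK⟩) hle⟩, ?_⟩
  rintro _ ⟨f, hf, rfl⟩
  exact hbound f hf r ⟨hr, hKL, hLK⟩

end Horo
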